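/- arXiv:1104.3793 — 2 statements merged into one kernel-verified Lean document; each statement's English description precedes it below -/
import Mathlib

section
/- Let V be a nonlocal vertex algebra and let W be a vector space equipped with a linear map Y_W(·,x): V → Hom(W, W((x))) with Y_W(1,x) = 1_W. Then W (with Y_W) is a V-module if and only if for all u,v ∈ V there exists a nonnegative integer k such that (x₁−x₂)^k Y_W(u,x₁)Y_W(v,x₂) ∈ Hom(W, W((x₁,x₂))) and ((x₁−x₂)^k Y_W(u,x₁)Y_W(v,x₂))|_{x₁=x₂+x₀} = x₀^k Y_W(Y(u,x₀)v,x₂). Furthermore, for a V-module W and any u,v ∈ V, the identity ((x₁−x₂)^k Y_W(u,x₁)Y_W(v,x₂))|_{x₁=x₂+x₀} = x₀^k Y_W(Y(u,x₀)v,x₂) holds for every nonnegative integer k satisfying (x₁−x₂)^k Y_W(u,x₁)Y_W(v,x₂) ∈ Hom(W, W((x₁,x₂))). -/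
open scoped TensorProduct BigOperators

noncomputable section

/-- Integer binomial coefficient `C(n, k)` for `n : ℤ`, `k : ℕ`. -/
def zchoose (n : ℤ) (k : ℕ) : ℤ :=
  if 0 ≤ n then ((n.toNat).choose k : ℤ)
  else (-1) ^ k * ((((k : ℤ) - n - 1).toNat).choose k)

section Series

variable {V : Type*} [AddCommGroup V] [Module ℂ V]

/-- `a` is (the coefficient family of) an element of `V((x))`. -/
def IsLaurent (a : ℤ → V) : Prop := ∃ N : ℤ, ∀ n : ℤ, n < N → a n = 0

/-- `a` is an element of `V[[x]]`. -/
def IsPowerSeries (a : ℤ → V) : Prop := ∀ n : ℤ, n < 0 → a n = 0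

/-- `A` is an element of `V((x₁, x₂))` (first index: exponent of `x₁`). -/
def IsLaurent2 (A : ℤ → ℤ → V) : Prop :=
  ∃ N : ℤ, ∀ m n : ℤ, (m < N ∨ n < N) → A m n = 0

/-- `a` is an element of `V ⊗ ℂ((x)) ⊆ V((x))`: truncated below, with coefficients
lying in a finitely generated (i.e. finite dimensional) subspace. -/
def IsTensorLaurent (a : ℤ → V) : Prop :=
  IsLaurent a ∧ ∃ F : Submodule ℂ V, F.FG ∧ ∀ n, a n ∈ F

/-- Multiply the double series `A(x₁,x₂)` by `(x₁+x₂)^k`. -/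
def mulAddPow (k : ℕ) (A : ℤ → ℤ → V) : ℤ → ℤ → V := fun a b =>
  ∑ j ∈ Finset.range (k + 1), ((k.choose j : ℕ) : ℂ) • A (a - (k : ℤ) + j) (b - j)

/-- Multiply the double series `A(x₁,x₂)` by `(x₁-x₂)^k`. -/
def mulSubPow (k : ℕ) (A : ℤ → ℤ → V) : ℤ → ℤ → V := fun a b =>
  ∑ j ∈ Finset.range (k + 1),
    ((-1 : ℂ) ^ j * ((k.choose j : ℕ) : ℂ)) • A (a - (k : ℤ) + j) (b - j)

/-- Multiply the double series `A(x₁,x₂)` by `(x₂-x₁)^k`. -/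
def mulSubPow' (k : ℕ) (A : ℤ → ℤ → V) : ℤ → ℤ → V := fun a b =>
  ∑ j ∈ Finset.range (k + 1),
    ((-1 : ℂ) ^ j * ((k.choose j : ℕ) : ℂ)) • A (a - j) (b - (k : ℤ) + j)

/-- Substitute `x₁ = x₀ + x₂` in `A(x₁,x₂)`, expanding in nonnegative powers of `x₂`.
The result is indexed by (exponent of `x₀`, exponent of `x₂`). -/
def substAdd02 (A : ℤ → ℤ → V) : ℤ → ℤ → V := fun a b =>
  ∑ᶠ i : ℕ, ((zchoose (a + i) i : ℤ) : ℂ) • A (a + i) (b - i)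

/-- Substitute `x₁ = x₂ + x₀` in `A(x₁,x₂)`, expanding in nonnegative powers of `x₀`.
The result is indexed by (exponent of `x₀`, exponent of `x₂`). -/
def substAdd20 (A : ℤ → ℤ → V) : ℤ → ℤ → V := fun a b =>
  if 0 ≤ a then ∑ᶠ m : ℤ, ((zchoose m a.toNat : ℤ) : ℂ) • A m (b - m + a) else 0

/-- Multiply the double series `A(x₁,x₂)` by `f(x₂ - x₁)`, expanded in nonnegative
powers of `x₁`. -/
def scalarMulSub (f : ℤ → ℂ) (A : ℤ → ℤ → V) : ℤ → ℤ → V := fun m n =>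
  ∑ᶠ (i : ℕ) (p : ℤ),
    ((-1 : ℂ) ^ i * ((zchoose p i : ℤ) : ℂ) * f p) • A (m - i) (n - p + i)

/-- Multiply a double series by a polynomial in two variables. -/
def polyMul2 (p : MvPolynomial (Fin 2) ℂ) (A : ℤ → ℤ → V) : ℤ → ℤ → V := fun m n =>
  ∑ d ∈ p.support, MvPolynomial.coeff d p • A (m - (d 0 : ℤ)) (n - (d 1 : ℤ))

/-- The relation `A ∼ B`: `p·A = p·B` for some nonzero polynomial `p(x₁,x₂)`. -/
def SimEq2 (A B : ℤ → ℤ → V) : Prop :=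
  ∃ p : MvPolynomial (Fin 2) ℂ, p ≠ 0 ∧ ∀ m n : ℤ, polyMul2 p A m n = polyMul2 p B m n

/-- `a` is an element of the iterated Laurent series space `V((x₁))⋯((x_n))`. -/
def IsIterLaurent : (n : ℕ) → ((Fin n → ℤ) → V) → Prop
  | 0, _ => True
  | n + 1, a =>
      (∃ N : ℤ, ∀ k : Fin (n + 1) → ℤ, k (Fin.last n) < N → a k = 0) ∧
      ∀ m : ℤ, IsIterLaurent n fun k => a (Fin.snoc k m)

end Series

/-- A nonlocal vertex algebra over `ℂ`, with `Y u v n` the coefficient of `x^n`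
in `Y(u,x)v` (so `u_m v = Y u v (-m-1)`). -/
structure NLVA (V : Type*) [AddCommGroup V] [Module ℂ V] where
  Y : V →ₗ[ℂ] V →ₗ[ℂ] (ℤ → V)
  one : V
  trunc : ∀ u v : V, IsLaurent (Y u v)
  vacuum_left : ∀ (v : V) (n : ℤ), Y one v n = if n = 0 then v else 0
  creation_reg : ∀ v : V, IsPowerSeries (Y v one)
  creation_zero : ∀ v : V, Y v one 0 = v
  weak_assoc : ∀ u v w : V, ∃ k : ℕ, ∀ a b : ℤ,
    mulAddPow k (substAdd02 fun m n => Y u (Y v w n) m) a b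
      = mulAddPow k (fun a' b' => Y (Y u v a') w b') a b

namespace NLVA

variable {U V K : Type*} [AddCommGroup U] [Module ℂ U] [AddCommGroup V] [Module ℂ V]
  [AddCommGroup K] [Module ℂ K]

/-- The coefficient `Y(·)_n(·)` as a bilinear map. -/
def Yc (𝒱 : NLVA V) (n : ℤ) : V →ₗ[ℂ] V →ₗ[ℂ] V :=
  𝒱.Y.compr₂ (LinearMap.proj n)

/-- The operator `D(v) = v_{-2}𝟙`, i.e. the coefficient of `x^1` in `Y(v,x)𝟙`. -/
def D (𝒱 : NLVA V) : V →ₗ[ℂ] V :=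
  (LinearMap.proj (1 : ℤ)).comp (𝒱.Y.flip 𝒱.one)

/-- Homomorphisms of nonlocal vertex algebras. -/
def IsHom (𝒰 : NLVA U) (𝒱 : NLVA V) (f : U →ₗ[ℂ] V) : Prop :=
  f 𝒰.one = 𝒱.one ∧ ∀ (a b : U) (n : ℤ), f (𝒰.Y a b n) = 𝒱.Y (f a) (f b) n

/-- `𝒦` is generated, as a nonlocal vertex algebra, by the subset `S`. -/
def IsGeneratedBy (𝒦 : NLVA K) (S : Set K) : Prop :=
  ∀ P : Submodule ℂ K, 𝒦.one ∈ P →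
    (∀ a ∈ P, ∀ b ∈ P, ∀ n : ℤ, 𝒦.Y a b n ∈ P) → S ⊆ P → P = ⊤

/-- `𝒰` is irreducible as a module over itself. -/
def SelfIrreducible (𝒰 : NLVA U) : Prop :=
  Nontrivial U ∧
    ∀ P : Submodule ℂ U, (∀ u : U, ∀ p ∈ P, ∀ n : ℤ, 𝒰.Y u p n ∈ P) → P = ⊥ ∨ P = ⊤

/-- The coefficients of the product `Y(v₁,x₁)⋯Y(v_n,x_n)𝟙`. -/
def prodY (𝒱 : NLVA V) : (n : ℕ) → (Fin n → V) → (Fin n → ℤ) → V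
  | 0, _, _ => 𝒱.one
  | n + 1, v, k => 𝒱.Y (v 0) (prodY 𝒱 n (fun i => v i.succ) fun i => k i.succ) (k 0)

/-- Non-degeneracy in the sense of Etingof–Kazhdan: the maps
`Z_n : V^{⊗n} ⊗ ℂ((x₁))⋯((x_n)) → V((x₁))⋯((x_n))` are injective. -/
def NonDegenerate (𝒱 : NLVA V) : Prop :=
  ∀ n : ℕ, 0 < n → ∀ (r : ℕ) (v : Fin r → Fin n → V) (f : Fin r → (Fin n → ℤ) → ℂ),
    (∀ j, IsIterLaurent n (f j)) →
    LinearIndependent ℂ (fun j : Fin r => PiTensorProduct.tprod ℂ (v j)) →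
    (∀ K' : Fin n → ℤ,
      (∑ j : Fin r, ∑ᶠ L : Fin n → ℤ,
        f j L • 𝒱.prodY n (v j) fun i => K' i - L i) = 0) →
    ∀ j, f j = 0

end NLVA

/-- Countable dimension over `ℂ`. -/
def CountableDim (U : Type*) [AddCommGroup U] [Module ℂ U] : Prop :=
  ∃ s : Set U, s.Countable ∧ Submodule.span ℂ s = ⊤

/-- `𝒱` satisfies `𝒮`-locality, i.e. is a weak quantum vertex algebra. -/
def SLocal {V : Type*} [AddCommGroup V] [Module ℂ V] (𝒱 : NLVA V) : Prop :=
  ∀ u v : V, ∃ (r : ℕ) (uu vv : Fin r → V) (f : Fin r → ℤ → ℂ) (k : ℕ),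
    (∀ i, IsLaurent (f i)) ∧ ∀ (w : V) (m n : ℤ),
      mulSubPow k (fun a b => 𝒱.Y u (𝒱.Y v w b) a) m n
        = mulSubPow k (fun a b => ∑ i, scalarMulSub (f i)
            (fun a' b' => 𝒱.Y (vv i) (𝒱.Y (uu i) w a') b') a b) m n

/-- A module for a nonlocal vertex algebra. -/
structure NLVAModule {V : Type*} [AddCommGroup V] [Module ℂ V] (𝒱 : NLVA V)
    (W : Type*) [AddCommGroup W] [Module ℂ W] where
  Yw : V →ₗ[ℂ] W →ₗ[ℂ] (ℤ → W)
  trunc : ∀ (v : V) (w : W), IsLaurent (Yw v w)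
  vacuum : ∀ (w : W) (n : ℤ), Yw 𝒱.one w n = if n = 0 then w else 0
  weak_assoc : ∀ (u v : V) (w : W), ∃ k : ℕ, ∀ a b : ℤ,
    mulAddPow k (substAdd02 fun m n => Yw u (Yw v w n) m) a b
      = mulAddPow k (fun a' b' => Yw (𝒱.Y u v a') w b') a b

section Twist

variable {U V : Type*} [AddCommGroup U] [Module ℂ U] [AddCommGroup V] [Module ℂ V]

/-- Coefficient of `x₁^m x₂^n` in `(Y(x₂)⊗1)R²³(x₁)R¹²(x₁+x₂)` applied to `v ⊗ u ⊗ u'`. -/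
def hex1RHS (𝒰 : NLVA U) (Rc : ℤ → (V ⊗[ℂ] U →ₗ[ℂ] U ⊗[ℂ] V))
    (v : V) (u u' : U) (m n : ℤ) : U ⊗[ℂ] V :=
  ∑ᶠ (i : ℕ) (c : ℤ),
    ((zchoose (m - c + i) i : ℤ) : ℂ) •
      (TensorProduct.map (TensorProduct.lift (𝒰.Yc (n - i))) LinearMap.id)
        ((TensorProduct.assoc ℂ U U V).symm
          ((LinearMap.lTensor U (Rc c))
            ((TensorProduct.assoc ℂ U V U)
              ((Rc (m - c + i) (v ⊗ₜ u)) ⊗ₜ u'))))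

/-- Coefficient of `x₁^m x₂^n` in `(1⊗Y(x₂))R¹²(x₁-x₂)R²³(x₁)` applied to `v ⊗ v' ⊗ u`. -/
def hex2RHS (𝒱 : NLVA V) (Rc : ℤ → (V ⊗[ℂ] U →ₗ[ℂ] U ⊗[ℂ] V))
    (v v' : V) (u : U) (m n : ℤ) : U ⊗[ℂ] V :=
  ∑ᶠ (i : ℕ) (c : ℤ),
    ((-1 : ℂ) ^ i * ((zchoose (m - c + i) i : ℤ) : ℂ)) •
      (LinearMap.lTensor U (TensorProduct.lift (𝒱.Yc (n - i))))
        ((TensorProduct.assoc ℂ U V V)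
          ((TensorProduct.map (Rc (m - c + i)) LinearMap.id)
            ((TensorProduct.assoc ℂ V U V).symm
              (v ⊗ₜ (Rc c (v' ⊗ₜ u))))))

/-- A twisting operator `R(x) : V ⊗ U → U ⊗ V ⊗ ℂ((x))` for the ordered pair `(U,V)`,
given by its family of coefficients `Rc n`. -/
structure TwistingOp (𝒰 : NLVA U) (𝒱 : NLVA V) where
  Rc : ℤ → (V ⊗[ℂ] U →ₗ[ℂ] U ⊗[ℂ] V)
  laurent : ∀ t : V ⊗[ℂ] U, IsTensorLaurent fun n => Rc n t
  vac_right : ∀ (v : V) (n : ℤ),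
    Rc n (v ⊗ₜ 𝒰.one) = if n = 0 then 𝒰.one ⊗ₜ v else 0
  vac_left : ∀ (u : U) (n : ℤ),
    Rc n (𝒱.one ⊗ₜ u) = if n = 0 then u ⊗ₜ 𝒱.one else 0
  hex1 : ∀ (v : V) (u u' : U) (m n : ℤ),
    Rc m (v ⊗ₜ (𝒰.Y u u' n)) = hex1RHS 𝒰 Rc v u u' m n
  hex2 : ∀ (v v' : V) (u : U) (m n : ℤ),
    Rc m ((𝒱.Y v v' n) ⊗ₜ u) = hex2RHS 𝒱 Rc v v' u m n

/-- `Sc` is a two-sided inverse of `Rc` as `ℂ((x))`-linear maps (coefficientwise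
convolution), with values in the tensor with `ℂ((x))`. -/
def IsInvPair {A B : Type*} [AddCommGroup A] [Module ℂ A] [AddCommGroup B] [Module ℂ B]
    (Rc : ℤ → (A →ₗ[ℂ] B)) (Sc : ℤ → (B →ₗ[ℂ] A)) : Prop :=
  (∀ t : B, IsTensorLaurent fun n => Sc n t) ∧
  (∀ (t : A) (n : ℤ), (∑ᶠ c : ℤ, Sc c (Rc (n - c) t)) = if n = 0 then t else 0) ∧
  (∀ (t : B) (n : ℤ), (∑ᶠ c : ℤ, Rc c (Sc (n - c) t)) = if n = 0 then t else 0)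

/-- The canonical embedding `u ↦ u ⊗ 𝟙`. -/
def iotaU (𝒱 : NLVA V) : U →ₗ[ℂ] U ⊗[ℂ] V := (TensorProduct.mk ℂ U V).flip 𝒱.one

/-- The canonical embedding `v ↦ 𝟙 ⊗ v`. -/
def iotaV (𝒰 : NLVA U) : V →ₗ[ℂ] U ⊗[ℂ] V := TensorProduct.mk ℂ U V 𝒰.one

/-- The operator `D ⊗ 1 + 1 ⊗ D` on `U ⊗ V`. -/
def DUV (𝒰 : NLVA U) (𝒱 : NLVA V) : U ⊗[ℂ] V →ₗ[ℂ] U ⊗[ℂ] V :=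
  LinearMap.rTensor V 𝒰.D + LinearMap.lTensor U 𝒱.D

/-- The coefficient of `x^n` in `Y_R(u⊗v, x)(u'⊗v') = (Y(x)⊗Y(x))R²³(-x)(u⊗v⊗u'⊗v')`. -/
def YRcoef (𝒰 : NLVA U) (𝒱 : NLVA V) (Rop : TwistingOp 𝒰 𝒱)
    (u : U) (v : V) (u' : U) (v' : V) (n : ℤ) : U ⊗[ℂ] V :=
  ∑ᶠ (c : ℤ) (a : ℤ),
    ((-1 : ℂ) ^ c) •
      (TensorProduct.map (𝒰.Yc a u) ((𝒱.Yc (n - c - a)).flip v'))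
        (Rop.Rc c (v ⊗ₜ u'))

/-- `𝒯` is the twisted tensor product nonlocal vertex algebra `U ⊗_R V`. -/
def IsTwistedTensor (𝒰 : NLVA U) (𝒱 : NLVA V) (Rop : TwistingOp 𝒰 𝒱)
    (𝒯 : NLVA (U ⊗[ℂ] V)) : Prop :=
  𝒯.one = 𝒰.one ⊗ₜ 𝒱.one ∧
  ∀ (u u' : U) (v v' : V) (n : ℤ),
    𝒯.Y (u ⊗ₜ v) (u' ⊗ₜ v') n = YRcoef 𝒰 𝒱 Rop u v u' v' n

end Twist

section Aux

variable {A B W T : Type*} [AddCommGroup A] [Module ℂ A] [AddCommGroup B] [Module ℂ B]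
  [AddCommGroup W] [Module ℂ W] [AddCommGroup T] [Module ℂ T]

/-- The linear map `(a ⊗ b) ↦ Y_A(a)_e (Y_B(b)_j w)`, i.e. the coefficient
of `Y_A(x₂)(1 ⊗ Y_B(x₁)) (· ⊗ · ⊗ w)` at `x₂^e x₁^j`. -/
def sandwichMod (YA : A →ₗ[ℂ] W →ₗ[ℂ] (ℤ → W)) (YB : B →ₗ[ℂ] W →ₗ[ℂ] (ℤ → W))
    (w : W) (e j : ℤ) : A ⊗[ℂ] B →ₗ[ℂ] W :=
  TensorProduct.lift
    ((YA.compr₂ (LinearMap.proj e)).compl₂ ((YB.compr₂ (LinearMap.proj j)).flip w))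

/-- Coefficient of `x₁^m x₂^n` in `Y_A(x₂)(1 ⊗ Y_B(x₁)) q(x₂ - x₁) (⋯ ⊗ w)`, where the
series `q` is evaluated at `x₂ - x₁`, expanded in nonnegative powers of `x₁`. -/
def twistRHS (YA : A →ₗ[ℂ] W →ₗ[ℂ] (ℤ → W)) (YB : B →ₗ[ℂ] W →ₗ[ℂ] (ℤ → W))
    (q : ℤ → A ⊗[ℂ] B) (w : W) : ℤ → ℤ → W := fun m n =>
  ∑ᶠ (i : ℕ) (p : ℤ),
    ((-1 : ℂ) ^ i * ((zchoose p i : ℤ) : ℂ)) •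
      sandwichMod YA YB w (n - p + i) (m - i) (q p)

/-- As `twistRHS`, but with `q` evaluated at `-x₂ + x₁`, expanded in nonnegative
powers of `x₂`. -/
def twistRHSalt (YA : A →ₗ[ℂ] W →ₗ[ℂ] (ℤ → W)) (YB : B →ₗ[ℂ] W →ₗ[ℂ] (ℤ → W))
    (q : ℤ → A ⊗[ℂ] B) (w : W) : ℤ → ℤ → W := fun m n =>
  ∑ᶠ (i : ℕ) (p : ℤ),
    ((-1 : ℂ) ^ i * ((zchoose p i : ℤ) : ℂ)) •
      sandwichMod YA YB w (n - i) (m - p + i) (q p)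

/-- Coefficient of `x^n` in `e^{xD} F(x)` where `F` is given by its coefficients. -/
def expD (Dop : T →ₗ[ℂ] T) (F : ℤ → T) (n : ℤ) : T :=
  ∑ᶠ j : ℕ, ((j.factorial : ℂ))⁻¹ • (Dop ^ j) (F (n - j))

end Aux

section YBE

variable {V : Type*} [AddCommGroup V] [Module ℂ V]

/-- The flip of the last two tensor factors of `(V⊗V)⊗V`. -/
def swap23 : (V ⊗[ℂ] V) ⊗[ℂ] V →ₗ[ℂ] (V ⊗[ℂ] V) ⊗[ℂ] V :=
  ((TensorProduct.assoc ℂ V V V).symm.toLinearMap).comp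
    ((LinearMap.lTensor V (TensorProduct.comm ℂ V V).toLinearMap).comp
      (TensorProduct.assoc ℂ V V V).toLinearMap)

/-- `S¹²` acting on `(V⊗V)⊗V`. -/
def S12m (Sc : ℤ → (V ⊗[ℂ] V →ₗ[ℂ] V ⊗[ℂ] V)) (c : ℤ) :
    (V ⊗[ℂ] V) ⊗[ℂ] V →ₗ[ℂ] (V ⊗[ℂ] V) ⊗[ℂ] V :=
  TensorProduct.map (Sc c) LinearMap.id

/-- `S²³` acting on `(V⊗V)⊗V`. -/
def S23m (Sc : ℤ → (V ⊗[ℂ] V →ₗ[ℂ] V ⊗[ℂ] V)) (c : ℤ) :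
    (V ⊗[ℂ] V) ⊗[ℂ] V →ₗ[ℂ] (V ⊗[ℂ] V) ⊗[ℂ] V :=
  ((TensorProduct.assoc ℂ V V V).symm.toLinearMap).comp
    ((LinearMap.lTensor V (Sc c)).comp (TensorProduct.assoc ℂ V V V).toLinearMap)

/-- `S¹³` acting on `(V⊗V)⊗V`. -/
def S13m (Sc : ℤ → (V ⊗[ℂ] V →ₗ[ℂ] V ⊗[ℂ] V)) (c : ℤ) :
    (V ⊗[ℂ] V) ⊗[ℂ] V →ₗ[ℂ] (V ⊗[ℂ] V) ⊗[ℂ] V :=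
  swap23.comp ((S12m Sc c).comp swap23)

/-- `S²¹(x) = σ S(x) σ`. -/
def S21c (Sc : ℤ → (V ⊗[ℂ] V →ₗ[ℂ] V ⊗[ℂ] V)) (c : ℤ) :
    V ⊗[ℂ] V →ₗ[ℂ] V ⊗[ℂ] V :=
  ((TensorProduct.comm ℂ V V).toLinearMap).comp
    ((Sc c).comp (TensorProduct.comm ℂ V V).toLinearMap)

/-- The quantum Yang–Baxter equation
`S¹²(x)S¹³(x+z)S²³(z) = S²³(z)S¹³(x+z)S¹²(x)` (coefficient of `x^a z^b`, with
`S¹³(x+z)` expanded in nonnegative powers of `z`). -/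
def QYBE (Sc : ℤ → (V ⊗[ℂ] V →ₗ[ℂ] V ⊗[ℂ] V)) : Prop :=
  ∀ (t : (V ⊗[ℂ] V) ⊗[ℂ] V) (a b : ℤ),
    (∑ᶠ (i : ℕ) (p : ℤ), ((zchoose p i : ℤ) : ℂ) •
        S12m Sc (a - p + i) (S13m Sc p (S23m Sc (b - i) t)))
      = ∑ᶠ (i : ℕ) (p : ℤ), ((zchoose p i : ℤ) : ℂ) •
          S23m Sc (b - i) (S13m Sc p (S12m Sc (a - p + i) t))

/-- Unitarity: `S(x) S²¹(-x) = 1`. -/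
def Unitary (Sc : ℤ → (V ⊗[ℂ] V →ₗ[ℂ] V ⊗[ℂ] V)) : Prop :=
  ∀ (t : V ⊗[ℂ] V) (n : ℤ),
    (∑ᶠ c : ℤ, ((-1 : ℂ) ^ (n - c)) • Sc c (S21c Sc (n - c) t))
      = if n = 0 then t else 0

/-- `[D ⊗ 1, S(x)] = -(d/dx) S(x)`. -/
def DComm1 (𝒱 : NLVA V) (Sc : ℤ → (V ⊗[ℂ] V →ₗ[ℂ] V ⊗[ℂ] V)) : Prop :=
  ∀ (t : V ⊗[ℂ] V) (n : ℤ),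
    (LinearMap.rTensor V 𝒱.D) (Sc n t) - Sc n ((LinearMap.rTensor V 𝒱.D) t)
      = (-((n : ℂ) + 1)) • Sc (n + 1) t

/-- `Y(u,x)v = e^{xD} Y(-x) S(-x)(v⊗u)`. -/
def SkewS (𝒱 : NLVA V) (Sc : ℤ → (V ⊗[ℂ] V →ₗ[ℂ] V ⊗[ℂ] V)) : Prop :=
  ∀ (u v : V) (n : ℤ),
    𝒱.Y u v n = expD 𝒱.D (fun p => ((-1 : ℂ) ^ p) •
      ∑ᶠ c : ℤ, (TensorProduct.lift (𝒱.Yc (p - c))) (Sc c (v ⊗ₜ u))) n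

/-- `S(x₁)(Y(x₂)⊗1) = (Y(x₂)⊗1)S²³(x₁)S¹³(x₁+x₂)`. -/
def HexY1 (𝒱 : NLVA V) (Sc : ℤ → (V ⊗[ℂ] V →ₗ[ℂ] V ⊗[ℂ] V)) : Prop :=
  ∀ (t : (V ⊗[ℂ] V) ⊗[ℂ] V) (m n : ℤ),
    Sc m ((TensorProduct.map (TensorProduct.lift (𝒱.Yc n)) LinearMap.id) t)
      = ∑ᶠ (i : ℕ) (p : ℤ), ((zchoose p i : ℤ) : ℂ) •
          (TensorProduct.map (TensorProduct.lift (𝒱.Yc (n - i))) LinearMap.id)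
            (S23m Sc (m - p + i) (S13m Sc p t))

/-- `S(x₁)(1⊗Y(x₂)) = (1⊗Y(x₂))S¹²(x₁-x₂)S¹³(x₁)`. -/
def HexY2 (𝒱 : NLVA V) (Sc : ℤ → (V ⊗[ℂ] V →ₗ[ℂ] V ⊗[ℂ] V)) : Prop :=
  ∀ (t : (V ⊗[ℂ] V) ⊗[ℂ] V) (m n : ℤ),
    Sc m ((LinearMap.lTensor V (TensorProduct.lift (𝒱.Yc n)))
        ((TensorProduct.assoc ℂ V V V) t))
      = ∑ᶠ (i : ℕ) (p : ℤ), ((-1 : ℂ) ^ i * ((zchoose p i : ℤ) : ℂ)) •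
          (LinearMap.lTensor V (TensorProduct.lift (𝒱.Yc (n - i))))
            ((TensorProduct.assoc ℂ V V V)
              (S12m Sc p (S13m Sc (m - p + i) t)))

/-- A quantum vertex algebra `(V, 𝒮)`. -/
structure QVA (V : Type*) [AddCommGroup V] [Module ℂ V] where
  alg : NLVA V
  sloc : SLocal alg
  Sc : ℤ → (V ⊗[ℂ] V →ₗ[ℂ] V ⊗[ℂ] V)
  laurent : ∀ t : V ⊗[ℂ] V, IsTensorLaurent fun n => Sc n t
  qybe : QYBE Sc
  unitary : Unitary Sc
  vac : ∀ (v : V) (n : ℤ), Sc n (alg.one ⊗ₜ v) = if n = 0 then alg.one ⊗ₜ v else 0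
  dcomm : DComm1 alg Sc
  skew : SkewS alg Sc
  hex : HexY1 alg Sc

end YBE

section Bialg

variable {H : Type*} [AddCommGroup H] [Module ℂ H]

/-- A nonlocal vertex bialgebra. -/
structure NLVBialg (H : Type*) [AddCommGroup H] [Module ℂ H] where
  alg : NLVA H
  comul : H →ₗ[ℂ] H ⊗[ℂ] H
  counit : H →ₗ[ℂ] ℂ
  coassoc : ∀ h : H, (LinearMap.lTensor H comul) (comul h)
      = (TensorProduct.assoc ℂ H H H) ((LinearMap.rTensor H comul) (comul h))
  counit_comul_left : ∀ h : H,
      (TensorProduct.lid ℂ H) ((LinearMap.rTensor H counit) (comul h)) = h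
  counit_comul_right : ∀ h : H,
      (TensorProduct.rid ℂ H) ((LinearMap.lTensor H counit) (comul h)) = h
  counit_one : counit alg.one = 1
  counit_mul : ∀ (a b : H) (n : ℤ),
      counit (alg.Y a b n) = if n = 0 then counit a * counit b else 0
  comul_one : comul alg.one = alg.one ⊗ₜ alg.one
  comul_mul : ∀ (a b : H) (n : ℤ),
      comul (alg.Y a b n)
        = ∑ᶠ p : ℤ, (TensorProduct.map₂ (alg.Yc p) (alg.Yc (n - p))) (comul a) (comul b)

/-- A nonlocal vertex `H`-module-algebra. -/
structure NLVModAlg (𝓗 : NLVBialg H) (U : Type*) [AddCommGroup U] [Module ℂ U] where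
  alg : NLVA U
  act : NLVAModule 𝓗.alg U
  scalar : ∀ (h : H) (u : U), IsTensorLaurent fun n => act.Yw h u n
  vac : ∀ (h : H) (n : ℤ),
      act.Yw h alg.one n = if n = 0 then 𝓗.counit h • alg.one else 0
  compat : ∀ (h : H) (u v : U) (m n : ℤ),
      act.Yw h (alg.Y u v n) m
        = ∑ᶠ (i : ℕ) (p : ℤ), ((-1 : ℂ) ^ i * ((zchoose p i : ℤ) : ℂ)) •
            (TensorProduct.lift
              (((alg.Yc (n - i)).comp ((act.Yw.compr₂ (LinearMap.proj p)).flip u)).compl₂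
                ((act.Yw.compr₂ (LinearMap.proj (m - p + i))).flip v)))
            (𝓗.comul h)

/-- A nonlocal vertex `H`-comodule-algebra. -/
structure NLVComodAlg (𝓗 : NLVBialg H) (V : Type*) [AddCommGroup V] [Module ℂ V] where
  alg : NLVA V
  rho : V →ₗ[ℂ] H ⊗[ℂ] V
  coassoc : ∀ v : V, (LinearMap.lTensor H rho) (rho v)
      = (TensorProduct.assoc ℂ H H V) ((LinearMap.rTensor V 𝓗.comul) (rho v))
  counit_rho : ∀ v : V,
      (TensorProduct.lid ℂ V) ((LinearMap.rTensor V 𝓗.counit) (rho v)) = v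
  rho_one : rho alg.one = 𝓗.alg.one ⊗ₜ alg.one
  rho_mul : ∀ (v v' : V) (n : ℤ),
      rho (alg.Y v v' n)
        = ∑ᶠ p : ℤ, (TensorProduct.map₂ (𝓗.alg.Yc p) (alg.Yc (n - p))) (rho v) (rho v')

/-- The coefficient of `x^n` in
`Y_♯(u⊗v, x)(u'⊗v') = Y(u,x)Y(b¹(v),x)u' ⊗ Y(v²,x)v'`. -/
def Ysharp (𝓗 : NLVBialg H) {U V : Type*} [AddCommGroup U] [Module ℂ U]
    [AddCommGroup V] [Module ℂ V] (MU : NLVModAlg 𝓗 U) (CV : NLVComodAlg 𝓗 V)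
    (u : U) (v : V) (u' : U) (v' : V) (n : ℤ) : U ⊗[ℂ] V :=
  ∑ᶠ (a : ℤ) (p : ℤ),
    (TensorProduct.map
      ((MU.alg.Yc a u).comp ((MU.act.Yw.compr₂ (LinearMap.proj p)).flip u'))
      ((CV.alg.Yc (n - a - p)).flip v'))
    (CV.rho v)

/-- Rearrangement `(H⊗V)⊗U → (H⊗U)⊗V`. -/
def smashSwap {U V : Type*} [AddCommGroup U] [Module ℂ U]
    [AddCommGroup V] [Module ℂ V] :
    (H ⊗[ℂ] V) ⊗[ℂ] U →ₗ[ℂ] (H ⊗[ℂ] U) ⊗[ℂ] V :=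
  ((TensorProduct.assoc ℂ H U V).symm.toLinearMap).comp
    ((LinearMap.lTensor H (TensorProduct.comm ℂ V U).toLinearMap).comp
      (TensorProduct.assoc ℂ H V U).toLinearMap)

/-- The coefficient of `x^n` in `R(x)(v⊗u) = Y(b¹(v),-x)u ⊗ v²`. -/
def Rsmash (𝓗 : NLVBialg H) {U V : Type*} [AddCommGroup U] [Module ℂ U]
    [AddCommGroup V] [Module ℂ V] (MU : NLVModAlg 𝓗 U) (CV : NLVComodAlg 𝓗 V)
    (n : ℤ) : V ⊗[ℂ] U →ₗ[ℂ] U ⊗[ℂ] V :=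
  ((-1 : ℂ) ^ n) •
    ((TensorProduct.map
        (TensorProduct.lift (MU.act.Yw.compr₂ (LinearMap.proj n))) LinearMap.id).comp
      (smashSwap.comp (LinearMap.rTensor U CV.rho)))

end Bialg

theorem zchoose_natCast (n k : ℕ) : zchoose (n : ℤ) k = (n.choose k : ℤ) := by
  simp [zchoose]

theorem zchoose_zero_right (n : ℤ) : zchoose n 0 = 1 := by
  simp [zchoose]

theorem zchoose_eq_zero {n : ℤ} {k : ℕ} (h0 : 0 ≤ n) (h : n < k) : zchoose n k = 0 := by
  lift n to ℕ using h0
  rw [zchoose_natCast, Nat.choose_eq_zero_of_lt (by exact_mod_cast h), Nat.cast_zero]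

/-- Pascal's rule for integer binomial coefficients. -/
theorem zchoose_succ_succ (n : ℤ) (k : ℕ) :
    zchoose (n + 1) (k + 1) = zchoose n k + zchoose n (k + 1) := by
  rcases lt_trichotomy n (-1) with h | rfl | h
  · obtain ⟨p, hp⟩ := Int.eq_ofNat_of_zero_le (show 0 ≤ -n - 2 by lia)
    obtain rfl : n = -(p : ℤ) - 2 := by lia
    rw [zchoose, zchoose, zchoose, if_neg (by lia), if_neg (by lia), if_neg (by lia)]
    rw [show (((k + 1 : ℕ) : ℤ) - (-(p : ℤ) - 2 + 1) - 1).toNat = k + p + 1 by lia,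
      show ((k : ℤ) - (-(p : ℤ) - 2) - 1).toNat = k + p + 1 by lia,
      show (((k + 1 : ℕ) : ℤ) - (-(p : ℤ) - 2) - 1).toNat = k + p + 1 + 1 by lia,
      Nat.choose_succ_succ (k + p + 1) k]
    push_cast
    ring
  · rw [show (-1 : ℤ) + 1 = 0 by lia, zchoose_eq_zero le_rfl (by lia), zchoose, zchoose,
      if_neg (by lia), if_neg (by lia)]
    rw [show ((k : ℤ) - (-1) - 1).toNat = k by lia,
      show (((k + 1 : ℕ) : ℤ) - (-1) - 1).toNat = k + 1 by lia, Nat.choose_self, Nat.choose_self]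
    push_cast
    ring
  · lift n to ℕ using by lia
    have : ((n : ℤ) + 1) = ((n + 1 : ℕ) : ℤ) := by push_cast; rfl
    rw [this, zchoose_natCast, zchoose_natCast, zchoose_natCast, Nat.choose_succ_succ]
    push_cast
    rfl

section DoubleSeries

variable {W : Type*} [AddCommGroup W] [Module ℂ W]

/-- Multiplication of a double series by its first variable. -/
def mulFst : Module.End ℂ (ℤ → ℤ → W) where
  toFun A := fun a b => A (a - 1) b
  map_add' _ _ := rfl
  map_smul' _ _ := rfl

/-- Multiplication of a double series by its second variable. -/
def mulSnd : Module.End ℂ (ℤ → ℤ → W) where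
  toFun A := fun a b => A a (b - 1)
  map_add' _ _ := rfl
  map_smul' _ _ := rfl

theorem mulFst_apply (A : ℤ → ℤ → W) (a b : ℤ) : mulFst A a b = A (a - 1) b := rfl

theorem mulSnd_apply (A : ℤ → ℤ → W) (a b : ℤ) : mulSnd A a b = A a (b - 1) := rfl

theorem mulFst_pow_apply (k : ℕ) (A : ℤ → ℤ → W) (a b : ℤ) :
    (mulFst ^ k) A a b = A (a - k) b := by
  induction k generalizing a with
  | zero => simp
  | succ k ih =>
    rw [pow_succ', Module.End.mul_apply, mulFst_apply, ih]
    congr 1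
    push_cast
    ring

theorem mulSnd_pow_apply (k : ℕ) (A : ℤ → ℤ → W) (a b : ℤ) :
    (mulSnd ^ k) A a b = A a (b - k) := by
  induction k generalizing b with
  | zero => simp
  | succ k ih =>
    rw [pow_succ', Module.End.mul_apply, mulSnd_apply, ih]
    congr 1
    push_cast
    ring

theorem commute_mulFst_mulSnd :
    Commute (mulFst : Module.End ℂ (ℤ → ℤ → W)) mulSnd := rfl

theorem commute_mulFst_add_mulSnd_pow {k l : ℕ} :
    Commute ((mulFst : Module.End ℂ (ℤ → ℤ → W)) ^ k) ((mulFst + mulSnd) ^ l) :=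
  ((Commute.refl _).add_right commute_mulFst_mulSnd).pow_pow k l

theorem mulAddPow_eq_pow (k : ℕ) (A : ℤ → ℤ → W) :
    mulAddPow k A = ((mulFst + mulSnd) ^ k : Module.End ℂ (ℤ → ℤ → W)) A := by
  funext a b
  rw [add_comm, commute_mulFst_mulSnd.symm.add_pow]
  simp only [mulAddPow, LinearMap.sum_apply, Finset.sum_apply]
  refine Finset.sum_congr rfl fun j hj => ?_
  have hj : j ≤ k := Nat.lt_succ_iff.mp (Finset.mem_range.mp hj)
  rw [Module.End.mul_apply, Module.End.mul_apply, mulSnd_pow_apply, mulFst_pow_apply,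
    Module.End.natCast_apply, Pi.smul_apply, Pi.smul_apply, Nat.cast_smul_eq_nsmul,
    Nat.cast_sub hj, sub_add]

theorem mulSubPow_eq_pow (k : ℕ) (A : ℤ → ℤ → W) :
    mulSubPow k A = ((mulFst - mulSnd) ^ k : Module.End ℂ (ℤ → ℤ → W)) A := by
  funext a b
  have hcomm : Commute (-mulSnd : Module.End ℂ (ℤ → ℤ → W)) mulFst :=
    (commute_mulFst_mulSnd (W := W)).symm.neg_left
  rw [sub_eq_neg_add, hcomm.add_pow]
  simp only [mulSubPow, LinearMap.sum_apply, Finset.sum_apply]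
  refine Finset.sum_congr rfl fun j hj => ?_
  have hj : j ≤ k := Nat.lt_succ_iff.mp (Finset.mem_range.mp hj)
  have hneg : (-mulSnd : Module.End ℂ (ℤ → ℤ → W)) ^ j = (-1 : ℂ) ^ j • mulSnd ^ j := by
    rw [← neg_one_smul ℂ (mulSnd : Module.End ℂ (ℤ → ℤ → W)), smul_pow]
  rw [hneg, Module.End.mul_apply, Module.End.mul_apply, LinearMap.smul_apply, Pi.smul_apply,
    Pi.smul_apply, mulSnd_pow_apply, mulFst_pow_apply, Module.End.natCast_apply, Pi.smul_apply,
    Pi.smul_apply, ← Nat.cast_smul_eq_nsmul ℂ, Nat.cast_sub hj, sub_add, mul_smul]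

/-- Double series whose exponents of the first variable are at least `N`. -/
def truncFst (N : ℤ) : Submodule ℂ (ℤ → ℤ → W) where
  carrier := {A | ∀ m n : ℤ, m < N → A m n = 0}
  add_mem' hA hB m n h := by simp [hA m n h, hB m n h]
  zero_mem' _ _ _ := rfl
  smul_mem' c A hA m n h := by simp [hA m n h]

/-- Double series whose exponents of the second variable are at least `N`. -/
def truncSnd (N : ℤ) : Submodule ℂ (ℤ → ℤ → W) where
  carrier := {A | ∀ m n : ℤ, n < N → A m n = 0}
  add_mem' hA hB m n h := by simp [hA m n h, hB m n h]
  zero_mem' _ _ _ := rfl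
  smul_mem' c A hA m n h := by simp [hA m n h]

theorem mulFst_mem_truncFst {N : ℤ} {A : ℤ → ℤ → W} (hA : A ∈ truncFst N) :
    mulFst A ∈ truncFst N := fun m n h => hA (m - 1) n (by lia)

theorem mulSnd_mem_truncFst {N : ℤ} {A : ℤ → ℤ → W} (hA : A ∈ truncFst N) :
    mulSnd A ∈ truncFst N := fun m n h => hA m (n - 1) h

theorem mulFst_mem_truncSnd {N : ℤ} {A : ℤ → ℤ → W} (hA : A ∈ truncSnd N) :
    mulFst A ∈ truncSnd N := fun m n h => hA (m - 1) n h

theorem mulSnd_mem_truncSnd {N : ℤ} {A : ℤ → ℤ → W} (hA : A ∈ truncSnd N) :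
    mulSnd A ∈ truncSnd N := fun m n h => hA m (n - 1) (by lia)

theorem isLaurent2_iff {A : ℤ → ℤ → W} :
    IsLaurent2 A ↔ ∃ N : ℤ, A ∈ truncFst N ⊓ truncSnd N :=
  exists_congr fun _ =>
    ⟨fun h => ⟨fun m n hm => h m n (Or.inl hm), fun m n hn => h m n (Or.inr hn)⟩,
      fun h m n hmn => hmn.elim (h.1 m n) (h.2 m n)⟩

/-- A map intertwining two endomorphisms on an invariant submodule intertwines their powers. -/
theorem map_pow_apply_of_intertwine {R E E' : Type*} [Semiring R] [AddCommMonoid E]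
    [AddCommMonoid E'] [Module R E] [Module R E'] {φ : E → E'} {f : Module.End R E}
    {g : Module.End R E'} {p : Submodule R E} (hf : ∀ x ∈ p, f x ∈ p)
    (hφ : ∀ x ∈ p, φ (f x) = g (φ x)) (n : ℕ) {x : E} (hx : x ∈ p) :
    φ ((f ^ n) x) = (g ^ n) (φ x) := by
  induction n with
  | zero => simp
  | succ n ih =>
    rw [pow_succ', pow_succ', Module.End.mul_apply, Module.End.mul_apply,
      hφ _ (Submodule.le_comap_pow_of_le_comap p hf n hx), ih]

/-- `substAdd02` as a finite sum. -/
theorem substAdd02_eq_sum {N : ℤ} {A : ℤ → ℤ → W} (hA : A ∈ truncSnd N) {K : ℕ} (a : ℤ) {b : ℤ}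
    (hK : b - K < N) :
    substAdd02 A a b
      = ∑ i ∈ Finset.range K, ((zchoose (a + i) i : ℤ) : ℂ) • A (a + i) (b - i) := by
  refine finsum_eq_sum_of_support_subset _ fun i hi => ?_
  by_contra h
  rw [Finset.coe_range, Set.mem_Iio] at h
  exact hi (by simp only [hA (a + i) (b - i) (by lia), smul_zero])

theorem finite_support_substAdd20 {N : ℤ} {A : ℤ → ℤ → W} (hA : A ∈ truncFst N ⊓ truncSnd N)
    (c : ℤ → ℂ) (b : ℤ) :
    (Function.support fun m : ℤ => c m • A m (b - m)).Finite := by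
  refine (Set.finite_Icc N (b - N)).subset fun m hm => ?_
  by_contra h
  refine hm ?_
  rw [Set.mem_Icc, not_and_or] at h
  rcases h with h | h
  · simp only [hA.1 m (b - m) (by lia), smul_zero]
  · simp only [hA.2 m (b - m) (by lia), smul_zero]

theorem substAdd02_sub {N : ℤ} {A B : ℤ → ℤ → W} (hA : A ∈ truncSnd N) (hB : B ∈ truncSnd N) :
    substAdd02 (A - B) = substAdd02 A - substAdd02 B := by
  funext a b
  have hK : b - ((b - N).toNat + 1 : ℕ) < N := by lia
  simp only [Pi.sub_apply, substAdd02_eq_sum (sub_mem hA hB) a hK, substAdd02_eq_sum hA a hK,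
    substAdd02_eq_sum hB a hK, smul_sub, Finset.sum_sub_distrib]

theorem substAdd02_mulSnd (A : ℤ → ℤ → W) :
    substAdd02 (mulSnd A) = mulSnd (substAdd02 A) := by
  funext a b
  simp only [substAdd02, mulSnd_apply]
  refine finsum_congr fun i => ?_
  rw [sub_right_comm]

theorem substAdd02_mulFst {N : ℤ} {A : ℤ → ℤ → W} (hA : A ∈ truncSnd N) :
    substAdd02 (mulFst A) = (mulFst + mulSnd : Module.End ℂ (ℤ → ℤ → W)) (substAdd02 A) := by
  funext a b
  obtain ⟨K, hK⟩ : ∃ K : ℕ, b - K < N := ⟨(b - N).toNat + 1, by lia⟩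
  rw [LinearMap.add_apply, Pi.add_apply, Pi.add_apply, mulFst_apply, mulSnd_apply,
    substAdd02_eq_sum (K := K + 1) (mulFst_mem_truncSnd hA) a (by lia),
    substAdd02_eq_sum (K := K + 1) hA (a - 1) (by lia),
    substAdd02_eq_sum (K := K) hA a (b := b - 1) (by lia),
    Finset.sum_range_succ', Finset.sum_range_succ', add_right_comm, ← Finset.sum_add_distrib]
  simp only [mulFst_apply]
  congr 1
  · refine Finset.sum_congr rfl fun i _ => ?_
    rw [show a + ((i + 1 : ℕ) : ℤ) = a + i + 1 by lia,
      show a - 1 + ((i + 1 : ℕ) : ℤ) = a + i by lia,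
      show b - ((i + 1 : ℕ) : ℤ) = b - 1 - i by lia, add_sub_cancel_right,
      zchoose_succ_succ, Int.cast_add, add_smul, add_comm]
  · simp [zchoose_zero_right]

theorem substAdd02_mulFst_sub_mulSnd {N : ℤ} {A : ℤ → ℤ → W} (hA : A ∈ truncSnd N) :
    substAdd02 ((mulFst - mulSnd : Module.End ℂ (ℤ → ℤ → W)) A) = mulFst (substAdd02 A) := by
  rw [LinearMap.sub_apply, substAdd02_sub (mulFst_mem_truncSnd hA) (mulSnd_mem_truncSnd hA),
    substAdd02_mulFst hA, substAdd02_mulSnd, LinearMap.add_apply, add_sub_cancel_right]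

theorem substAdd20_of_neg (A : ℤ → ℤ → W) {a : ℤ} (ha : a < 0) (b : ℤ) :
    substAdd20 A a b = 0 := if_neg (not_le.mpr ha)

theorem substAdd20_natCast (A : ℤ → ℤ → W) (a : ℕ) (b : ℤ) :
    substAdd20 A a b = ∑ᶠ m : ℤ, ((zchoose m a : ℤ) : ℂ) • A m (b + a - m) := by
  rw [substAdd20, if_pos (Int.natCast_nonneg a), Int.toNat_natCast]
  exact finsum_congr fun m => by rw [sub_add_eq_add_sub]

theorem substAdd20_mulFst {N : ℤ} {A : ℤ → ℤ → W} (hA : A ∈ truncFst N ⊓ truncSnd N) :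
    substAdd20 (mulFst A) = (mulFst + mulSnd : Module.End ℂ (ℤ → ℤ → W)) (substAdd20 A) := by
  funext a b
  rw [LinearMap.add_apply, Pi.add_apply, Pi.add_apply, mulFst_apply, mulSnd_apply]
  rcases lt_or_ge a 0 with ha | ha
  · rw [substAdd20_of_neg _ ha, substAdd20_of_neg _ ha, substAdd20_of_neg _ (by lia), add_zero]
  lift a to ℕ using ha
  rw [substAdd20_natCast, substAdd20_natCast, ← finsum_comp_equiv (Equiv.addRight (1 : ℤ))]
  simp only [Equiv.coe_addRight, mulFst_apply, add_sub_cancel_right]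
  cases a with
  | zero =>
    rw [substAdd20_of_neg _ (by simp), zero_add]
    refine finsum_congr fun m => ?_
    rw [zchoose_zero_right, zchoose_zero_right]
    congr 2
    ring
  | succ a =>
    rw [show ((a + 1 : ℕ) : ℤ) - 1 = a by lia, substAdd20_natCast,
      show b - 1 + ((a + 1 : ℕ) : ℤ) = b + a by lia,
      ← finsum_add_distrib (finite_support_substAdd20 hA _ _) (finite_support_substAdd20 hA _ _)]
    refine finsum_congr fun m => ?_
    rw [zchoose_succ_succ, Int.cast_add, add_smul,
      show b + ((a + 1 : ℕ) : ℤ) - (m + 1) = b + a - m by lia]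

/-- Expanding a nonnegative power of `x₀ + x₂` does not depend on the order of the variables. -/
theorem substAdd20_eq_substAdd02 {A : ℤ → ℤ → W} (hA : A ∈ truncFst 0) :
    substAdd20 A = substAdd02 A := by
  funext a b
  rcases lt_or_ge a 0 with ha | ha
  · rw [substAdd20_of_neg _ ha]
    refine (finsum_eq_zero_of_forall_eq_zero fun i => ?_).symm
    rcases lt_or_ge (a + i) 0 with h | h
    · rw [hA _ _ h, smul_zero]
    · rw [zchoose_eq_zero h (by lia), Int.cast_zero, zero_smul]
  lift a to ℕ using ha
  have hinj : Function.Injective fun i : ℕ => (a : ℤ) + i := fun i j h => by simpa using h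
  let f : ℤ → W := fun m => ((zchoose m a : ℤ) : ℂ) • A m (b + a - m)
  have hf : ∀ m, f m = ((zchoose m a : ℤ) : ℂ) • A m (b + a - m) := fun _ => rfl
  have hsupp : Function.support f ⊆ Set.range fun i : ℕ => (a : ℤ) + i := by
    intro m hm
    by_contra h
    have hma : m < a := by
      by_contra hma
      exact h ⟨(m - a).toNat, by simp only; lia⟩
    refine hm ?_
    rcases lt_or_ge m 0 with h0 | h0
    · rw [hf, hA m _ h0, smul_zero]
    · rw [hf, zchoose_eq_zero h0 hma, Int.cast_zero, zero_smul]
  rw [substAdd20_natCast, ← funext hf, ← Set.indicator_eq_self.mpr hsupp, ← finsum_mem_def,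
    finsum_mem_range hinj]
  refine finsum_congr fun i => ?_
  rw [hf, ← Nat.cast_add, zchoose_natCast, zchoose_natCast, Nat.choose_symm_add]
  congr 2
  lia

theorem mem_truncFst_of_substAdd02 {N : ℤ} {A : ℤ → ℤ → W} (hA : A ∈ truncSnd N)
    (h : substAdd02 A ∈ truncFst 0) : A ∈ truncFst 0 := by
  suffices ∀ (d : ℕ) (m n : ℤ), n < N + d → m < 0 → A m n = 0 from
    fun m n hm => this (n - N + 1).toNat m n (by lia) hm
  intro d
  induction d with
  | zero => exact fun m n hn _ => hA m n (by simpa using hn)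
  | succ d ih =>
    intro m n hn hm
    have h0 := h m n hm
    rw [substAdd02, finsum_eq_single _ 0] at h0
    · simpa [zchoose_zero_right] using h0
    · intro i hi
      rcases lt_or_ge (m + i) 0 with hmi | hmi
      · rw [ih _ _ (by lia) hmi, smul_zero]
      · rw [zchoose_eq_zero hmi (by lia), Int.cast_zero, zero_smul]

theorem eq_zero_of_mulFst_add_mulSnd {M : ℤ} {A : ℤ → ℤ → W} (hA : A ∈ truncFst M)
    (h : (mulFst + mulSnd : Module.End ℂ (ℤ → ℤ → W)) A = 0) : A = 0 := by
  suffices ∀ (d : ℕ) (a b : ℤ), a < M + d → A a b = 0 from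
    funext fun a => funext fun b => this (a - M + 1).toNat a b (by lia)
  intro d
  induction d with
  | zero => exact fun a b ha => hA a b (by simpa using ha)
  | succ d ih =>
    intro a b ha
    have h0 := congrFun (congrFun h a) (b + 1)
    rw [LinearMap.add_apply, Pi.add_apply, Pi.add_apply, mulFst_apply, mulSnd_apply,
      ih (a - 1) _ (by lia), zero_add, add_sub_cancel_right] at h0
    exact h0

theorem mulFst_add_mulSnd_mem_truncFst {M : ℤ} {A : ℤ → ℤ → W} (hA : A ∈ truncFst M) :
    (mulFst + mulSnd : Module.End ℂ (ℤ → ℤ → W)) A ∈ truncFst M :=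
  add_mem (mulFst_mem_truncFst hA) (mulSnd_mem_truncFst hA)

theorem mulFst_sub_mulSnd_mem_truncSnd {M : ℤ} {A : ℤ → ℤ → W} (hA : A ∈ truncSnd M) :
    (mulFst - mulSnd : Module.End ℂ (ℤ → ℤ → W)) A ∈ truncSnd M :=
  sub_mem (mulFst_mem_truncSnd hA) (mulSnd_mem_truncSnd hA)

theorem mulFst_add_mulSnd_pow_injOn (M : ℤ) (l : ℕ) :
    Set.InjOn ((mulFst + mulSnd : Module.End ℂ (ℤ → ℤ → W)) ^ l) (truncFst (W := W) M) := by
  refine LinearMap.injOn_of_disjoint_ker subset_rfl (Submodule.disjoint_def.mpr fun A hA h => ?_)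
  rw [LinearMap.mem_ker] at h
  induction l with
  | zero => simpa using h
  | succ l ih =>
    rw [pow_succ', Module.End.mul_apply] at h
    exact ih (eq_zero_of_mulFst_add_mulSnd
      (Submodule.le_comap_pow_of_le_comap (truncFst M)
        (fun _ => mulFst_add_mulSnd_mem_truncFst) l hA) h)

/-- Weak associativity makes `(x₁ - x₂)^k F(x₁, x₂)` an element of `W((x₁, x₂))`, where `k` bounds
the pole at `x₀ = 0` of `G(x₀, x₂)`. -/
theorem isLaurent2_of_weakAssoc {N : ℤ} {F G : ℤ → ℤ → W} (hF : F ∈ truncSnd N) {k l : ℕ}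
    (hG : G ∈ truncFst (-k))
    (h : mulAddPow l (substAdd02 F) = mulAddPow l G) : IsLaurent2 (mulSubPow k F) := by
  rw [mulAddPow_eq_pow, mulAddPow_eq_pow] at h
  rw [mulSubPow_eq_pow]
  set B := ((mulFst - mulSnd : Module.End ℂ (ℤ → ℤ → W)) ^ k) F with hB
  have hBN : B ∈ truncSnd N := Submodule.le_comap_pow_of_le_comap _
    (fun _ => mulFst_sub_mulSnd_mem_truncSnd) k hF
  have hHN : (mulFst ^ l) B ∈ truncSnd N := Submodule.le_comap_pow_of_le_comap _
    (fun _ => mulFst_mem_truncSnd) l hBN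
  have hH : (mulFst ^ l) B ∈ truncFst 0 := by
    refine mem_truncFst_of_substAdd02 hHN ?_
    rw [map_pow_apply_of_intertwine (fun _ => mulFst_mem_truncSnd) (fun _ => substAdd02_mulFst) l
        hBN, hB,
      map_pow_apply_of_intertwine (fun _ => mulFst_sub_mulSnd_mem_truncSnd)
        (fun _ => substAdd02_mulFst_sub_mulSnd) k hF,
      ← Module.End.mul_apply, ← commute_mulFst_add_mulSnd_pow.eq, Module.End.mul_apply, h]
    intro a b ha
    rw [mulFst_pow_apply]
    exact Submodule.le_comap_pow_of_le_comap _ (fun _ => mulFst_add_mulSnd_mem_truncFst) l hG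
      (a - k) b (by lia)
  refine isLaurent2_iff.mpr ⟨min (-l) N, fun m n hm => ?_, fun m n hn => hBN m n (by lia)⟩
  have := hH (m + l) n (by lia)
  rwa [mulFst_pow_apply, add_sub_cancel_right] at this

/-- The substitution `x₁ = x₂ + x₀` in `x₁^l (x₁ - x₂)^k F(x₁, x₂)`. -/
theorem substAdd20_pow_eq {N : ℤ} {F : ℤ → ℤ → W} (hF : F ∈ truncSnd N) {k : ℕ}
    (hB : IsLaurent2 (mulSubPow k F)) :
    ∃ l₀ : ℕ, ∀ l ≥ l₀, ((mulFst + mulSnd : Module.End ℂ (ℤ → ℤ → W)) ^ l)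
        (substAdd20 (mulSubPow k F))
      = (mulFst ^ k) (((mulFst + mulSnd : Module.End ℂ (ℤ → ℤ → W)) ^ l) (substAdd02 F)) := by
  obtain ⟨M, hM⟩ := isLaurent2_iff.mp hB
  refine ⟨(-M).toNat, fun l hl => ?_⟩
  have hH : (mulFst ^ l) (mulSubPow k F) ∈ truncFst 0 := fun m n hm => by
    rw [mulFst_pow_apply]
    exact hM.1 _ _ (by lia)
  rw [← map_pow_apply_of_intertwine (φ := substAdd20) (f := mulFst)
      (p := truncFst M ⊓ truncSnd M) (fun _ hx => ⟨mulFst_mem_truncFst hx.1, mulFst_mem_truncSnd hx.2⟩)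
      (fun _ => substAdd20_mulFst) l hM,
    substAdd20_eq_substAdd02 hH,
    map_pow_apply_of_intertwine (fun _ => mulFst_mem_truncSnd) (fun _ => substAdd02_mulFst) l hM.2,
    mulSubPow_eq_pow,
    map_pow_apply_of_intertwine (fun _ => mulFst_sub_mulSnd_mem_truncSnd)
      (fun _ => substAdd02_mulFst_sub_mulSnd) k hF,
    ← Module.End.mul_apply, ← commute_mulFst_add_mulSnd_pow.eq, Module.End.mul_apply]

/-- For `(x₁ - x₂)^k F(x₁, x₂)` in `W((x₁, x₂))`, the two forms of weak associativity agree. -/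
theorem weakAssoc_iff_substAdd20 {N M : ℤ} {F G : ℤ → ℤ → W} (hF : F ∈ truncSnd N)
    (hG : G ∈ truncFst M) {k : ℕ} (hB : IsLaurent2 (mulSubPow k F)) :
    (∃ l : ℕ, mulAddPow l (substAdd02 F) = mulAddPow l G) ↔
      substAdd20 (mulSubPow k F) = (mulFst ^ k) G := by
  obtain ⟨l₀, hl₀⟩ := substAdd20_pow_eq hF hB
  simp only [mulAddPow_eq_pow]
  constructor
  · rintro ⟨l, hl⟩
    refine mulFst_add_mulSnd_pow_injOn (min 0 (M + k)) (l₀ + l) ?_ ?_ ?_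
    · exact fun a b ha => substAdd20_of_neg _ (by lia) b
    · intro a b ha
      rw [mulFst_pow_apply]
      exact hG _ _ (by lia)
    · have hT : ((mulFst + mulSnd : Module.End ℂ (ℤ → ℤ → W)) ^ (l₀ + l)) (substAdd02 F)
          = ((mulFst + mulSnd : Module.End ℂ (ℤ → ℤ → W)) ^ (l₀ + l)) G := by
        rw [pow_add, Module.End.mul_apply, hl, Module.End.mul_apply]
      rw [hl₀ _ (Nat.le_add_right _ _), hT]
      exact LinearMap.congr_fun commute_mulFst_add_mulSnd_pow.eq G
  · intro h
    refine ⟨l₀, ?_⟩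
    have h1 := hl₀ l₀ le_rfl
    rw [h, ← Module.End.mul_apply, ← commute_mulFst_add_mulSnd_pow.eq, Module.End.mul_apply] at h1
    funext a b
    have h2 := congrFun (congrFun h1 (a + k)) b
    rw [mulFst_pow_apply, mulFst_pow_apply, add_sub_cancel_right] at h2
    exact h2.symm

end DoubleSeries

/-- Characterization of module structures via the second form of weak
associativity (Lemma 2.2). -/
theorem statement_0 {V W : Type*} [AddCommGroup V] [Module ℂ V]
    [AddCommGroup W] [Module ℂ W]
    (𝒱 : NLVA V) (Yw : V →ₗ[ℂ] W →ₗ[ℂ] (ℤ → W))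
    (htrunc : ∀ (v : V) (w : W), IsLaurent (Yw v w))
    (hvac : ∀ (w : W) (n : ℤ), Yw 𝒱.one w n = if n = 0 then w else 0) :
    ((∀ (u v : V) (w : W), ∃ l : ℕ, ∀ a b : ℤ,
        mulAddPow l (substAdd02 fun m n => Yw u (Yw v w n) m) a b
          = mulAddPow l (fun a' b' => Yw (𝒱.Y u v a') w b') a b)
      ↔ (∀ u v : V, ∃ k : ℕ,
          (∀ w : W, IsLaurent2 (mulSubPow k fun m n => Yw u (Yw v w n) m)) ∧
          ∀ (w : W) (a b : ℤ),
            substAdd20 (mulSubPow k fun m n => Yw u (Yw v w n) m) a b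
              = Yw (𝒱.Y u v (a - k)) w b))
    ∧ ((∀ (u v : V) (w : W), ∃ l : ℕ, ∀ a b : ℤ,
        mulAddPow l (substAdd02 fun m n => Yw u (Yw v w n) m) a b
          = mulAddPow l (fun a' b' => Yw (𝒱.Y u v a') w b') a b) →
        ∀ (u v : V) (k : ℕ),
          (∀ w : W, IsLaurent2 (mulSubPow k fun m n => Yw u (Yw v w n) m)) →
          ∀ (w : W) (a b : ℤ),
            substAdd20 (mulSubPow k fun m n => Yw u (Yw v w n) m) a b
              = Yw (𝒱.Y u v (a - k)) w b) := by
  have hF : ∀ (u v : V) (w : W),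
      ∃ N : ℤ, (fun m n => Yw u (Yw v w n) m) ∈ truncSnd (W := W) N := by
    intro u v w
    obtain ⟨N, hN⟩ := htrunc v w
    exact ⟨N, fun m n hn => by simp [hN n hn]⟩
  have hG : ∀ u v : V, ∃ k : ℕ, ∀ w : W,
      (fun a b => Yw (𝒱.Y u v a) w b) ∈ truncFst (W := W) (-k) := by
    intro u v
    obtain ⟨N, hN⟩ := 𝒱.trunc u v
    exact ⟨(-N).toNat, fun w a b ha => by simp [hN a (by lia)]⟩
  have second : (∀ (u v : V) (w : W), ∃ l : ℕ, ∀ a b : ℤ,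
      mulAddPow l (substAdd02 fun m n => Yw u (Yw v w n) m) a b
        = mulAddPow l (fun a' b' => Yw (𝒱.Y u v a') w b') a b) →
      ∀ (u v : V) (k : ℕ),
        (∀ w : W, IsLaurent2 (mulSubPow k fun m n => Yw u (Yw v w n) m)) →
        ∀ (w : W) (a b : ℤ),
          substAdd20 (mulSubPow k fun m n => Yw u (Yw v w n) m) a b
            = Yw (𝒱.Y u v (a - k)) w b := by
    intro h u v k hB w a b
    obtain ⟨N, hN⟩ := hF u v w
    obtain ⟨M, hM⟩ := hG u v
    obtain ⟨l, hl⟩ := h u v w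
    rw [(weakAssoc_iff_substAdd20 hN (hM w) (hB w)).mp
      ⟨l, funext fun a => funext fun b => hl a b⟩, mulFst_pow_apply]
  refine ⟨⟨fun h u v => ?_, fun h u v w => ?_⟩, second⟩
  · obtain ⟨k, hk⟩ := hG u v
    have hB : ∀ w : W, IsLaurent2 (mulSubPow k fun m n => Yw u (Yw v w n) m) := by
      intro w
      obtain ⟨N, hN⟩ := hF u v w
      obtain ⟨l, hl⟩ := h u v w
      exact isLaurent2_of_weakAssoc hN (hk w) (funext fun a => funext fun b => hl a b)
    exact ⟨k, hB, second h u v k hB⟩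
  · obtain ⟨k, hB, hk⟩ := h u v
    obtain ⟨N, hN⟩ := hF u v w
    obtain ⟨M, hM⟩ := hG u v
    obtain ⟨l, hl⟩ := (weakAssoc_iff_substAdd20 hN (hM w) (hB w)).mpr
      (funext fun a => funext fun b => by rw [hk w a b, mulFst_pow_apply])
    exact ⟨l, fun a b => congrFun (congrFun hl a) b⟩
end
end

section
/- Let U and V be nonlocal vertex algebras, R(x) a twisting operator for (U,V), and U⊗_R V the twisted tensor product nonlocal vertex algebra. Then: (1) the D-operator of U⊗_R V equals D⊗1 + 1⊗D, where the two D's are the D-operators of U and V; (2) Y_R(u⊗1,x)(1⊗v) ∈ (U⊗V)[[x]] for all u ∈ U, v ∈ V; (3) Y_R(1⊗v,x)(u⊗1) = e^{x(D⊗1+1⊗D)} Y_R(−x) R(−x)(v⊗u) for all u ∈ U, v ∈ V, where on the right R(−x)(v⊗u) ∈ U⊗V⊗ℂ((x)) is identified with an element of (U⊗_R V)⊗(U⊗_R V)⊗ℂ((x)) via the embeddings u ↦ u⊗1, v ↦ 1⊗v. -/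
open scoped TensorProduct BigOperators

noncomputable section

section DividedPowers

variable {T : Type*} [AddCommGroup T] [Module ℂ T]

/-- The divided power `A^m / m!`, with value `0` for negative `m`. -/
def divPow (A : T →ₗ[ℂ] T) (m : ℤ) : T →ₗ[ℂ] T :=
  if 0 ≤ m then ((m.toNat.factorial : ℂ))⁻¹ • A ^ m.toNat else 0

lemma divPow_natCast (A : T →ₗ[ℂ] T) (m : ℕ) :
    divPow A m = ((m.factorial : ℂ))⁻¹ • A ^ m := by
  simp [divPow]

lemma divPow_of_neg (A : T →ₗ[ℂ] T) {m : ℤ} (hm : m < 0) : divPow A m = 0 := by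
  simp [divPow, not_le.mpr hm]

/-- The coefficient of `x^m` in `e^{x(A+B)} e^{-xA} = e^{xB}`. -/
lemma sum_exp_add_mul_exp_neg {A B : T →ₗ[ℂ] T} (hAB : Commute A B) (m : ℕ) :
    ∑ j ∈ Finset.range (m + 1), ((j.factorial : ℂ))⁻¹ • ((A + B) ^ j *
      ((-1 : ℂ) ^ (m - j) • (((m - j).factorial : ℂ))⁻¹ • A ^ (m - j)))
      = ((m.factorial : ℂ))⁻¹ • B ^ m := by
  have hc : Commute (A + B) (-A) := ((Commute.refl A).add_left hAB.symm).neg_right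
  have h := hc.add_pow m
  rw [show A + B + -A = B by abel] at h
  rw [h, Finset.smul_sum]
  refine Finset.sum_congr rfl fun j hj => ?_
  have hj' : j ≤ m := Nat.lt_succ_iff.mp (Finset.mem_range.mp hj)
  have hch : ((m.factorial : ℂ))⁻¹ * (m.choose j : ℂ)
      = ((j.factorial : ℂ))⁻¹ * (((m - j).factorial : ℂ))⁻¹ := by
    rw [Nat.cast_choose ℂ hj']
    have := Nat.cast_ne_zero (R := ℂ).mpr m.factorial_ne_zero
    have := Nat.cast_ne_zero (R := ℂ).mpr j.factorial_ne_zero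
    have := Nat.cast_ne_zero (R := ℂ).mpr (m - j).factorial_ne_zero
    field_simp
  have hneg : (-A) ^ (m - j) = (-1 : ℂ) ^ (m - j) • A ^ (m - j) := by
    rw [← neg_one_smul ℂ A, smul_pow]
  have hnat : (A + B) ^ j * (-A) ^ (m - j) * ((m.choose j : ℕ) : T →ₗ[ℂ] T)
      = (m.choose j : ℂ) • ((A + B) ^ j * (-A) ^ (m - j)) := by
    rw [← nsmul_eq_mul', Nat.cast_smul_eq_nsmul]
  rw [hnat, hneg, smul_smul (_⁻¹) (m.choose j : ℂ), hch]
  simp only [mul_smul_comm, smul_smul]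
  congr 1
  ring

/-- `e^{x(A+B)} e^{-xA} r(-x) = e^{xB} r(-x)` for a Laurent series `r` and commuting
operators `A`, `B`. -/
lemma expD_add_of_commute {A B : T →ₗ[ℂ] T} (hAB : Commute A B) {r : ℤ → T}
    (hr : IsLaurent r) (n : ℤ) :
    expD (A + B) (fun p => (-1 : ℂ) ^ p • ∑ᶠ c : ℤ, divPow A (p - c) (r c)) n
      = ∑ᶠ c : ℤ, (-1 : ℂ) ^ c • divPow B (n - c) (r c) := by
  obtain ⟨N, hN⟩ := hr
  have hinner : ∀ p ≤ n, ∑ᶠ c : ℤ, divPow A (p - c) (r c)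
      = ∑ c ∈ Finset.Icc N n, divPow A (p - c) (r c) := by
    intro p hp
    refine finsum_eq_sum_of_support_subset _ fun c hc => ?_
    rw [Finset.coe_Icc, Set.mem_Icc]
    by_contra h
    refine hc ?_
    rcases lt_or_ge c N with h1 | h1
    · simp [hN c h1]
    · change divPow A (p - c) (r c) = 0
      rw [divPow_of_neg A (by lia), LinearMap.zero_apply]
  have hright : ∑ᶠ c : ℤ, (-1 : ℂ) ^ c • divPow B (n - c) (r c)
      = ∑ c ∈ Finset.Icc N n, (-1 : ℂ) ^ c • divPow B (n - c) (r c) := by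
    refine finsum_eq_sum_of_support_subset _ fun c hc => ?_
    rw [Finset.coe_Icc, Set.mem_Icc]
    by_contra h
    refine hc ?_
    rcases lt_or_ge c N with h1 | h1
    · simp [hN c h1]
    · change _ • divPow B (n - c) (r c) = 0
      rw [divPow_of_neg B (by lia), LinearMap.zero_apply, smul_zero]
  have hleft : expD (A + B) (fun p => (-1 : ℂ) ^ p • ∑ᶠ c : ℤ, divPow A (p - c) (r c)) n
      = ∑ j ∈ Finset.range ((n - N).toNat + 1), ∑ c ∈ Finset.Icc N n,
        ((j.factorial : ℂ))⁻¹ • ((A + B) ^ j)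
          ((-1 : ℂ) ^ (n - j) • divPow A (n - j - c) (r c)) := by
    unfold expD
    rw [finsum_eq_sum_of_support_subset (s := Finset.range ((n - N).toNat + 1))]
    · refine Finset.sum_congr rfl fun j _ => ?_
      beta_reduce
      rw [hinner (n - j) (by lia), Finset.smul_sum, map_sum, Finset.smul_sum]
    · intro j hj
      rw [Finset.coe_range, Set.mem_Iio]
      by_contra h
      refine hj ?_
      change _ • ((A + B) ^ j) _ = 0
      beta_reduce
      rw [hinner (n - j) (by lia), Finset.sum_eq_zero, smul_zero, map_zero, smul_zero]
      intro c hc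
      have := Finset.mem_Icc.mp hc
      rw [divPow_of_neg A (by lia), LinearMap.zero_apply]
  rw [hleft, hright, Finset.sum_comm]
  refine Finset.sum_congr rfl fun c hc => ?_
  obtain ⟨hc1, hc2⟩ := Finset.mem_Icc.mp hc
  obtain ⟨m, hm⟩ := Int.eq_ofNat_of_zero_le (sub_nonneg.mpr hc2)
  rw [hm, divPow_natCast, ← sum_exp_add_mul_exp_neg hAB m, LinearMap.sum_apply, Finset.smul_sum]
  symm
  refine Finset.sum_subset_zero_on_sdiff (Finset.range_mono (by lia)) ?_ ?_
  · intro j hj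
    have : ¬ j < m + 1 := fun h => (Finset.mem_sdiff.mp hj).2 (Finset.mem_range.mpr h)
    rw [divPow_of_neg A (by lia)]
    simp
  · intro j hj
    have hj' : j ≤ m := Nat.lt_succ_iff.mp (Finset.mem_range.mp hj)
    have h1 : n - (j : ℤ) - c = ((m - j : ℕ) : ℤ) := by lia
    have h2 : n - (j : ℤ) = c + ((m - j : ℕ) : ℤ) := by lia
    rw [h1, divPow_natCast, h2, zpow_add₀ (by norm_num), zpow_natCast]
    simp only [LinearMap.smul_apply, Module.End.mul_apply, map_smul, smul_smul]
    congr 1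
    ring

end DividedPowers

section Creation

variable {V : Type*} [AddCommGroup V] [Module ℂ V]

/-- Multiplication by `(x₁+x₂)^k` is injective on series with no negative powers
of `x₁`. -/
lemma eq_of_mulAddPow_eq {k : ℕ} {A B : ℤ → ℤ → V}
    (hA : ∀ a < 0, ∀ b, A a b = 0) (hB : ∀ a < 0, ∀ b, B a b = 0)
    (h : ∀ a b, mulAddPow k A a b = mulAddPow k B a b) (a b : ℤ) : A a b = B a b := by
  have key : ∀ m : ℕ, ∀ a < (m : ℤ), ∀ b, A a b = B a b := by
    intro m
    induction m with
    | zero => intro a ha b; rw [hA a (by simpa using ha), hB a (by simpa using ha)]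
    | succ m ih =>
      intro a ha b
      have h' := h a (b + k)
      unfold mulAddPow at h'
      rw [Finset.sum_range_succ, Finset.sum_range_succ] at h'
      have hs : ∀ j ∈ Finset.range k,
          ((k.choose j : ℕ) : ℂ) • A (a - (k : ℤ) + j) (b + k - j)
            = ((k.choose j : ℕ) : ℂ) • B (a - (k : ℤ) + j) (b + k - j) := by
        intro j hj
        have := Finset.mem_range.mp hj
        rw [ih (a - k + j) (by lia)]
      rw [Finset.sum_congr rfl hs] at h'
      simpa using h'
  exact key (a.toNat + 1) a (by lia) b

namespace NLVA

variable (𝒱 : NLVA V)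

lemma Y_one_one (v : V) (a b : ℤ) :
    𝒱.Y (𝒱.Y v 𝒱.one a) 𝒱.one b
      = if 0 ≤ b then ((zchoose (a + b) b.toNat : ℤ) : ℂ) • 𝒱.Y v 𝒱.one (a + b) else 0 := by
  obtain ⟨k, hk⟩ := 𝒱.weak_assoc v 𝒱.one 𝒱.one
  have hsub : ∀ a b : ℤ, substAdd02 (fun m n => 𝒱.Y v (𝒱.Y 𝒱.one 𝒱.one n) m) a b
      = if 0 ≤ b then ((zchoose (a + b) b.toNat : ℤ) : ℂ) • 𝒱.Y v 𝒱.one (a + b) else 0 := by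
    intro a b
    unfold substAdd02
    split_ifs with hb
    · rw [finsum_eq_single _ b.toNat]
      · simp [hb, 𝒱.vacuum_left]
      · intro i hi
        have : b - (i : ℤ) ≠ 0 := by lia
        simp [𝒱.vacuum_left, this]
    · refine finsum_eq_zero_of_forall_eq_zero fun i => ?_
      have : b - (i : ℤ) ≠ 0 := by lia
      simp [𝒱.vacuum_left, this]
  rw [← hsub]
  refine (eq_of_mulAddPow_eq (fun a ha b => ?_) (fun a ha b => ?_) hk a b).symm
  · rw [hsub]
    split_ifs with hb
    · rcases lt_or_ge (a + b) 0 with h | h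
      · rw [𝒱.creation_reg v _ h, smul_zero]
      · rw [zchoose, if_pos h, Nat.choose_eq_zero_of_lt (by lia)]
        simp
    · rfl
  · simp [𝒱.creation_reg v a ha]

lemma D_apply (v : V) : 𝒱.D v = 𝒱.Y v 𝒱.one 1 := rfl

/-- `Y(v,x)𝟙 = e^{xD} v`. -/
lemma Y_one_eq_divPow (v : V) (n : ℤ) : 𝒱.Y v 𝒱.one n = divPow 𝒱.D n v := by
  rcases lt_or_ge n 0 with h | h
  · rw [𝒱.creation_reg v n h, divPow_of_neg _ h]; rfl
  · obtain ⟨m, rfl⟩ := Int.eq_ofNat_of_zero_le h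
    rw [divPow_natCast]
    clear h
    induction m with
    | zero => simp [𝒱.creation_zero]
    | succ m ih =>
      have h1 := 𝒱.Y_one_one v m 1
      rw [← D_apply, ih, if_pos zero_le_one, zchoose, if_pos (by lia)] at h1
      have h2 : ((m : ℤ) + 1).toNat = m + 1 := by lia
      have h3 : ((m : ℂ) + 1) ≠ 0 := Nat.cast_add_one_ne_zero m
      simp only [h2, Int.toNat_one, Nat.choose_one_right] at h1
      push_cast at h1 ⊢
      rw [← inv_smul_eq_iff₀ h3] at h1
      rw [← h1, Nat.factorial_succ, pow_succ', LinearMap.smul_apply, LinearMap.smul_apply,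
        map_smul, smul_smul, Module.End.mul_apply]
      push_cast
      rw [mul_inv]

lemma Yc_one_left (n : ℤ) : 𝒱.Yc n 𝒱.one = if n = 0 then LinearMap.id else 0 := by
  ext v
  change 𝒱.Y 𝒱.one v n = _
  rw [𝒱.vacuum_left]
  split_ifs <;> rfl

lemma Yc_flip_one (n : ℤ) : (𝒱.Yc n).flip 𝒱.one = divPow 𝒱.D n := by
  ext v
  exact 𝒱.Y_one_eq_divPow v n

end NLVA

end Creation

section TwistedTensor

variable {U V : Type*} [AddCommGroup U] [Module ℂ U] [AddCommGroup V] [Module ℂ V]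

lemma lTensor_divPow (A : V →ₗ[ℂ] V) (n : ℤ) :
    LinearMap.lTensor U (divPow A n) = divPow (LinearMap.lTensor U A) n := by
  unfold divPow
  split_ifs
  · rw [LinearMap.lTensor_smul, LinearMap.lTensor_pow]
  · exact LinearMap.lTensor_zero U

lemma rTensor_divPow (A : U →ₗ[ℂ] U) (n : ℤ) :
    LinearMap.rTensor V (divPow A n) = divPow (LinearMap.rTensor V A) n := by
  unfold divPow
  split_ifs
  · rw [LinearMap.rTensor_smul, LinearMap.rTensor_pow]
  · exact LinearMap.rTensor_zero V

lemma commute_rTensor_lTensor (A : U →ₗ[ℂ] U) (B : V →ₗ[ℂ] V) :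
    Commute (LinearMap.rTensor V A) (LinearMap.lTensor U B) := by
  change _ ∘ₗ _ = _ ∘ₗ _
  rw [LinearMap.rTensor_comp_lTensor, LinearMap.lTensor_comp_rTensor]

variable {𝒰 : NLVA U} {𝒱 : NLVA V} {Rop : TwistingOp 𝒰 𝒱}

lemma YRcoef_one_right (u : U) (v v' : V) (n : ℤ) :
    YRcoef 𝒰 𝒱 Rop u v 𝒰.one v' n
      = ∑ᶠ a : ℤ, 𝒰.Y u 𝒰.one a ⊗ₜ[ℂ] 𝒱.Y v v' (n - a) := by
  unfold YRcoef
  rw [finsum_eq_single _ 0]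
  · simp [Rop.vac_right, NLVA.Yc]
  · intro c hc
    simp [Rop.vac_right, hc]

namespace IsTwistedTensor

variable {𝒯 : NLVA (U ⊗[ℂ] V)}

lemma D_eq (h𝒯 : IsTwistedTensor 𝒰 𝒱 Rop 𝒯) : 𝒯.D = DUV 𝒰 𝒱 := by
  refine TensorProduct.ext' fun u v => ?_
  rw [𝒯.D_apply, h𝒯.1, h𝒯.2, YRcoef_one_right,
    finsum_eq_sum_of_support_subset (s := ({0, 1} : Finset ℤ))]
  · simp [𝒰.creation_zero, 𝒱.creation_zero, DUV, NLVA.D_apply, add_comm]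
  · intro a ha
    by_contra h
    refine ha ?_
    simp only [Finset.coe_insert, Finset.coe_singleton, Set.mem_insert_iff,
      Set.mem_singleton_iff, not_or] at h
    rcases lt_or_ge a 0 with h1 | h1
    · simp [𝒰.creation_reg u a h1]
    · simp [𝒱.creation_reg v (1 - a) (by lia)]

lemma Y_iotaU_iotaV (h𝒯 : IsTwistedTensor 𝒰 𝒱 Rop 𝒯) (u : U) (v : V) (n : ℤ) :
    𝒯.Y (iotaU 𝒱 u) (iotaV 𝒰 v) n = 𝒰.Y u 𝒰.one n ⊗ₜ v := by
  change 𝒯.Y (u ⊗ₜ 𝒱.one) (𝒰.one ⊗ₜ v) n = _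
  rw [h𝒯.2, YRcoef_one_right, finsum_eq_single _ n]
  · simp [𝒱.vacuum_left]
  · intro a ha
    simp [𝒱.vacuum_left, sub_ne_zero.mpr ha.symm]

lemma Y_iotaV_iotaU (h𝒯 : IsTwistedTensor 𝒰 𝒱 Rop 𝒯) (u : U) (v : V) (n : ℤ) :
    𝒯.Y (iotaV 𝒰 v) (iotaU 𝒱 u) n
      = ∑ᶠ c : ℤ, (-1 : ℂ) ^ c •
        divPow (LinearMap.lTensor U 𝒱.D) (n - c) (Rop.Rc c (v ⊗ₜ u)) := by
  change 𝒯.Y (𝒰.one ⊗ₜ v) (u ⊗ₜ 𝒱.one) n = _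
  rw [h𝒯.2, YRcoef]
  refine finsum_congr fun c => ?_
  rw [finsum_eq_single _ 0]
  · rw [𝒰.Yc_one_left, if_pos rfl, 𝒱.Yc_flip_one, sub_zero, ← lTensor_divPow]
    rfl
  · intro a ha
    rw [𝒰.Yc_one_left, if_neg ha, TensorProduct.map_zero_left, LinearMap.zero_apply, smul_zero]

lemma lift_Yc_comp_map_iota (h𝒯 : IsTwistedTensor 𝒰 𝒱 Rop 𝒯) (n : ℤ) (t : U ⊗[ℂ] V) :
    TensorProduct.lift (𝒯.Yc n) (TensorProduct.map (iotaU 𝒱) (iotaV 𝒰) t)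
      = divPow (LinearMap.rTensor V 𝒰.D) n t := by
  rw [← rTensor_divPow]
  induction t with
  | zero => simp
  | add x y hx hy => simp only [map_add, hx, hy]
  | tmul u v =>
    rw [LinearMap.rTensor_tmul, ← 𝒰.Y_one_eq_divPow]
    exact h𝒯.Y_iotaU_iotaV u v n

end IsTwistedTensor

end TwistedTensor

/-- Basic properties of the twisted tensor product `U ⊗_R V`
(Proposition 2.5): the `D`-operator is `D⊗1 + 1⊗D`; `Y_R(u,x)v` has no negative
powers; and the skew-symmetry relation
`Y_R(v,x)u = e^{x(D⊗1+1⊗D)} Y_R(-x) R(-x)(v⊗u)` holds. -/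
theorem statement_3 {U V : Type*} [AddCommGroup U] [Module ℂ U]
    [AddCommGroup V] [Module ℂ V]
    (𝒰 : NLVA U) (𝒱 : NLVA V) (Rop : TwistingOp 𝒰 𝒱)
    (𝒯 : NLVA (U ⊗[ℂ] V)) (h𝒯 : IsTwistedTensor 𝒰 𝒱 Rop 𝒯) :
    𝒯.D = DUV 𝒰 𝒱 ∧
    (∀ (u : U) (v : V), IsPowerSeries (𝒯.Y (iotaU 𝒱 u) (iotaV 𝒰 v))) ∧
    (∀ (u : U) (v : V) (n : ℤ),
      𝒯.Y (iotaV 𝒰 v) (iotaU 𝒱 u) n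
        = expD (DUV 𝒰 𝒱) (fun p => ((-1 : ℂ) ^ p) •
            ∑ᶠ c : ℤ, (TensorProduct.lift (𝒯.Yc (p - c)))
              ((TensorProduct.map (iotaU 𝒱) (iotaV 𝒰)) (Rop.Rc c (v ⊗ₜ u)))) n) := by
  refine ⟨h𝒯.D_eq, fun u v n hn => ?_, fun u v n => ?_⟩
  · rw [h𝒯.Y_iotaU_iotaV, 𝒰.creation_reg u n hn, TensorProduct.zero_tmul]
  · simp only [h𝒯.lift_Yc_comp_map_iota]
    rw [h𝒯.Y_iotaV_iotaU]
    exact (expD_add_of_commute (commute_rTensor_lTensor 𝒰.D 𝒱.D)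
      (Rop.laurent (v ⊗ₜ u)).1 n).symm
end
end
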